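/- arXiv:2102.01371 — 2 statements merged into one kernel-verified Lean document; each statement's English description precedes it below -/
import Mathlib

section
/- Let α ∈ (1,2) and n ≥ 1 an integer, let H_n be the Hankel matrix associated with G_n^{(α)}, and let τ(G_n^{(α)}) = G_n^{(α)} − H_n. If λ ∈ ℝ and z ∈ ℝⁿ is a nonzero vector such that H_n·z = λ·τ(G_n^{(α)})·z, then |λ| < 1/2; that is, all eigenvalues of τ(G_n^{(α)})^{−1}·H_n lie in the open interval (−1/2, 1/2). -/
/-- Grünwald–Letnikov coefficients: `g 0 = 1`, `g k = (1 - (α+1)/k) * g (k-1)` for `k ≥ 1`. -/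
noncomputable def glCoef (α : ℝ) : ℕ → ℝ
  | 0 => 1
  | k + 1 => (1 - (α + 1) / ((k : ℝ) + 1)) * glCoef α k

/-- First-column entries of `G_n^{(α)}`: `t_0 = -2g_1`, `t_1 = -(g_0+g_2)`, `t_k = -g_{k+1}` for `k ≥ 2`. -/
noncomputable def tC (α : ℝ) : ℕ → ℝ
  | 0 => -2 * glCoef α 1
  | 1 => -(glCoef α 0 + glCoef α 2)
  | k + 2 => -glCoef α (k + 3)

/-- Padded coefficients: `t_k` for `k < n`, `0` for `k ≥ n`. -/
noncomputable def tpad (n : ℕ) (t : ℕ → ℝ) (k : ℕ) : ℝ := if k < n then t k else 0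

/-- The `n×n` symmetric Toeplitz matrix with `(i,j)` entry `t_{|i-j|}`. -/
noncomputable def toeplitzM (n : ℕ) (t : ℕ → ℝ) : Matrix (Fin n) (Fin n) ℝ :=
  fun i j => t (Nat.dist i.val j.val)

/-- The Hankel matrix `(H_n)_{ij} = t_{i+j} + t_{2(n+1)-(i+j)}` (1-based indices,
with the convention `t_k = 0` for `k ≥ n`). Here `i j : Fin n` are 0-based. -/
noncomputable def hankelM (n : ℕ) (t : ℕ → ℝ) : Matrix (Fin n) (Fin n) ℝ :=
  fun i j => tpad n t (i.val + j.val + 2) + tpad n t (2 * n - (i.val + j.val))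

/-- The τ-matrix `τ(T_n) = T_n - H_n`. -/
noncomputable def tauM (n : ℕ) (t : ℕ → ℝ) : Matrix (Fin n) (Fin n) ℝ :=
  toeplitzM n t - hankelM n t

/-- The matrix `G_n^{(α)}`. -/
noncomputable def Gmat (α : ℝ) (n : ℕ) : Matrix (Fin n) (Fin n) ℝ := toeplitzM n (tC α)

theorem glCoef_succ (α : ℝ) (k : ℕ) :
    glCoef α (k + 1) = (1 - (α + 1) / ((k : ℝ) + 1)) * glCoef α k := rfl

theorem glCoef_one (α : ℝ) : glCoef α 1 = -α := by
  simp [glCoef]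

theorem glCoef_pos {α : ℝ} (hα : α ∈ Set.Ioo (1 : ℝ) 2) (k : ℕ) : 0 < glCoef α (k + 2) := by
  obtain ⟨h1, h2⟩ := hα
  induction k with
  | zero =>
    rw [glCoef_succ, glCoef_one]
    push_cast
    nlinarith
  | succ k ih =>
    rw [glCoef_succ]
    refine mul_pos ?_ ih
    rw [sub_pos, div_lt_one (by positivity)]
    push_cast
    linarith [k.cast_nonneg (α := ℝ)]

theorem glCoef_succ_le {α : ℝ} (hα : α ∈ Set.Ioo (1 : ℝ) 2) (k : ℕ) :
    glCoef α (k + 3) ≤ glCoef α (k + 2) := by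
  rw [glCoef_succ]
  refine mul_le_of_le_one_left (glCoef_pos hα k).le ?_
  have : 0 ≤ (α + 1) / (((k + 2 : ℕ) : ℝ) + 1) :=
    div_nonneg (by linarith [hα.1]) (by positivity)
  linarith

theorem mul_sum_range_glCoef (α : ℝ) (m : ℕ) :
    α * ∑ k ∈ Finset.range m, glCoef α k = -(m * glCoef α m) := by
  induction m with
  | zero => simp
  | succ m ih =>
    rw [Finset.sum_range_succ, mul_add, ih, glCoef_succ]
    push_cast
    field_simp
    ring

theorem sum_range_glCoef_neg {α : ℝ} (hα : α ∈ Set.Ioo (1 : ℝ) 2) (m : ℕ) :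
    ∑ k ∈ Finset.range (m + 2), glCoef α k < 0 := by
  have h := mul_sum_range_glCoef α (m + 2)
  have hpos : 0 < ((m + 2 : ℕ) : ℝ) * glCoef α (m + 2) :=
    mul_pos (by positivity) (glCoef_pos hα m)
  refine neg_of_mul_neg_right (a := α) ?_ (by linarith [hα.1])
  linarith

theorem tC_zero (α : ℝ) : tC α 0 = 2 * α := by
  simp [tC, glCoef_one]

theorem tC_succ_nonpos {α : ℝ} (hα : α ∈ Set.Ioo (1 : ℝ) 2) (k : ℕ) : tC α (k + 1) ≤ 0 := by
  cases k with
  | zero =>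
    have : glCoef α 0 = 1 := rfl
    have h2 := glCoef_pos hα 0
    simp only [zero_add, tC] at h2 ⊢
    linarith
  | succ k =>
    have := glCoef_pos hα (k + 1)
    simp only [tC]
    linarith

theorem monotone_tC_succ {α : ℝ} (hα : α ∈ Set.Ioo (1 : ℝ) 2) :
    Monotone fun k => tC α (k + 1) := by
  refine monotone_nat_of_le_succ fun k => ?_
  cases k with
  | zero =>
    have : glCoef α 0 = 1 := rfl
    have h2 := glCoef_succ_le hα 0
    simp only [zero_add, tC] at h2 ⊢
    linarith
  | succ k =>
    have := glCoef_succ_le hα (k + 1)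
    simp only [tC]
    linarith

theorem sum_range_neg_tC_succ (α : ℝ) (m : ℕ) :
    ∑ k ∈ Finset.range (m + 1), -tC α (k + 1) = α + ∑ k ∈ Finset.range (m + 3), glCoef α k := by
  induction m with
  | zero => simp [Finset.sum_range_succ, tC, glCoef_one]; ring
  | succ m ih =>
    rw [Finset.sum_range_succ, ih, Finset.sum_range_succ _ (m + 3)]
    simp only [tC]
    ring

theorem sum_range_neg_tC_succ_lt {α : ℝ} (hα : α ∈ Set.Ioo (1 : ℝ) 2) (m : ℕ) :
    ∑ k ∈ Finset.range m, -tC α (k + 1) < α := by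
  cases m with
  | zero => simpa using zero_lt_one.trans hα.1
  | succ m =>
    rw [sum_range_neg_tC_succ]
    linarith [sum_range_glCoef_neg hα (m + 1)]

/-- The absolute values of the off-diagonal Toeplitz coefficients, extended by zero. -/
noncomputable def offDiag (n : ℕ) (t : ℕ → ℝ) (k : ℕ) : ℝ := if k = 0 then 0 else -tpad n t k

theorem offDiag_nonneg {α : ℝ} (hα : α ∈ Set.Ioo (1 : ℝ) 2) (n k : ℕ) :
    0 ≤ offDiag n (tC α) k := by
  cases k with
  | zero => simp [offDiag]
  | succ k =>
    have := tC_succ_nonpos hα k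
    simp only [offDiag, tpad]
    split_ifs <;> simp [this]

theorem offDiag_eq_zero_of_le {n k : ℕ} (t : ℕ → ℝ) (h : n ≤ k) : offDiag n t k = 0 := by
  simp [offDiag, tpad, h.not_gt]

theorem offDiag_anti {α : ℝ} (hα : α ∈ Set.Ioo (1 : ℝ) 2) (n : ℕ) {k l : ℕ} (hk : k ≠ 0)
    (hkl : k ≤ l) : offDiag n (tC α) l ≤ offDiag n (tC α) k := by
  rcases le_or_gt n l with hl | hl
  · rw [offDiag_eq_zero_of_le _ hl]
    exact offDiag_nonneg hα n k
  · obtain ⟨k, rfl⟩ := Nat.exists_eq_succ_of_ne_zero hk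
    obtain ⟨l, rfl⟩ := Nat.exists_eq_succ_of_ne_zero (by omega : l ≠ 0)
    have := monotone_tC_succ hα (by omega : k ≤ l)
    simpa [offDiag, tpad, hl, hkl.trans_lt hl] using this

theorem sum_range_offDiag_lt {α : ℝ} (hα : α ∈ Set.Ioo (1 : ℝ) 2) (n : ℕ) :
    ∑ k ∈ Finset.range n, offDiag n (tC α) k < α := by
  cases n with
  | zero => simpa using zero_lt_one.trans hα.1
  | succ n =>
    rw [Finset.sum_range_succ']
    refine lt_of_eq_of_lt ?_ (sum_range_neg_tC_succ_lt hα n)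
    rw [offDiag, if_pos rfl, add_zero]
    refine Finset.sum_congr rfl fun k hk => ?_
    have := Finset.mem_range.mp hk
    simp [offDiag, tpad, this]

theorem sum_range_add_sum_range_shift_le {a : ℕ → ℝ} {n : ℕ} (ha : ∀ k, 0 ≤ a k)
    (ha' : ∀ k, n ≤ k → a k = 0) (m : ℕ) :
    ∑ j ∈ Finset.range (m + 1), a j + ∑ j ∈ Finset.range n, a (m + 2 + j) ≤
      ∑ j ∈ Finset.range n, a j := by
  have h1 : ∑ j ∈ Finset.range (m + 2 + n), a j = ∑ j ∈ Finset.range n, a j := by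
    rw [add_comm, Finset.sum_range_add]
    simp [fun j => ha' (n + j) (by omega)]
  rw [← h1, Finset.sum_range_add _ (m + 2), Finset.sum_range_succ _ (m + 1)]
  linarith [ha (m + 1)]

/-- A row of the Toeplitz matrix together with the same row of its Hankel correction covers each
coefficient at most twice. -/
theorem sum_toeplitz_row_add_hankel_row_le {a : ℕ → ℝ} {n : ℕ} (ha : ∀ k, 0 ≤ a k)
    (ha0 : a 0 = 0) (ha' : ∀ k, n ≤ k → a k = 0) {i : ℕ} (hi : i < n) :
    ∑ j ∈ Finset.range n, (a (Nat.dist i j) + (a (i + j + 2) + a (2 * n - (i + j)))) ≤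
      2 * ∑ k ∈ Finset.range n, a k := by
  obtain ⟨m, hm⟩ := Nat.exists_eq_add_of_lt hi
  have hdist : ∑ j ∈ Finset.range n, a (Nat.dist i j) =
      ∑ j ∈ Finset.range (i + 1), a j + ∑ j ∈ Finset.range (m + 1), a j := by
    rw [show n = i + (m + 1) by omega, Finset.sum_range_add, Finset.sum_range_succ' _ i, ha0,
      add_zero, ← Finset.sum_range_reflect (fun j => a (j + 1))]
    congr 1
    · refine Finset.sum_congr rfl fun j hj => ?_
      have := Finset.mem_range.mp hj
      rw [Nat.dist_eq_sub_of_le_right (by omega)]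
      congr 1
      omega
    · refine Finset.sum_congr rfl fun j _ => ?_
      rw [Nat.dist_eq_sub_of_le (by omega)]
      congr 1
      omega
  have hrefl : ∑ j ∈ Finset.range n, a (2 * n - (i + j)) =
      ∑ j ∈ Finset.range n, a (m + 2 + j) := by
    rw [← Finset.sum_range_reflect]
    refine Finset.sum_congr rfl fun j hj => ?_
    have := Finset.mem_range.mp hj
    congr 1
    omega
  have hshift : ∑ j ∈ Finset.range n, a (i + j + 2) = ∑ j ∈ Finset.range n, a (i + 2 + j) :=
    Finset.sum_congr rfl fun j _ => by congr 1; omega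
  rw [Finset.sum_add_distrib, Finset.sum_add_distrib, hdist, hrefl, hshift]
  linarith [sum_range_add_sum_range_shift_le ha ha' i, sum_range_add_sum_range_shift_le ha ha' m]

theorem hankelM_eq_neg_offDiag {n : ℕ} (t : ℕ → ℝ) (i j : Fin n) :
    hankelM n t i j =
      -(offDiag n t (i.val + j.val + 2) + offDiag n t (2 * n - (i.val + j.val))) := by
  have : 2 * n - (i.val + j.val) ≠ 0 := by omega
  simp only [offDiag, if_neg this, hankelM]
  simp
  ring

theorem toeplitzM_eq_neg_offDiag {n : ℕ} (t : ℕ → ℝ) {i j : Fin n} (hij : i ≠ j) :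
    toeplitzM n t i j = -offDiag n t (Nat.dist i.val j.val) := by
  have h0 : Nat.dist i.val j.val ≠ 0 := fun h => hij (Fin.ext (Nat.eq_of_dist_eq_zero h))
  have hlt : Nat.dist i.val j.val < n := by
    simp only [Nat.dist]
    omega
  simp [offDiag, h0, toeplitzM, tpad, hlt]

theorem offDiag_hankel_le {α : ℝ} (hα : α ∈ Set.Ioo (1 : ℝ) 2) {n : ℕ} {i j : Fin n}
    (hij : i ≠ j) :
    offDiag n (tC α) (i.val + j.val + 2) + offDiag n (tC α) (2 * n - (i.val + j.val)) ≤
      offDiag n (tC α) (Nat.dist i.val j.val) := by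
  have h0 : Nat.dist i.val j.val ≠ 0 := fun h => hij (Fin.ext (Nat.eq_of_dist_eq_zero h))
  rcases le_or_gt n (i.val + j.val + 2) with h | h
  · rw [offDiag_eq_zero_of_le _ h, zero_add]
    refine offDiag_anti hα n h0 ?_
    simp only [Nat.dist]
    omega
  · rw [offDiag_eq_zero_of_le (k := 2 * n - (i.val + j.val)) _ (by omega), add_zero]
    refine offDiag_anti hα n h0 ?_
    simp only [Nat.dist]
    omega

/-- For `-1 ≤ μ ≤ 3` the matrix `T - μ H` is strictly diagonally dominant. -/
theorem det_toeplitzM_sub_smul_hankelM_ne_zero {α : ℝ} (hα : α ∈ Set.Ioo (1 : ℝ) 2) (n : ℕ)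
    {μ : ℝ} (hlo : -1 ≤ μ) (hhi : μ ≤ 3) :
    (toeplitzM n (tC α) - μ • hankelM n (tC α)).det ≠ 0 := by
  refine det_ne_zero_of_sum_row_lt_diag fun i => ?_
  set a := offDiag n (tC α) with ha_def
  have ha : ∀ k, 0 ≤ a k := offDiag_nonneg hα n
  have ha0 : a 0 = 0 := by simp [ha_def, offDiag]
  let K : Fin n → ℝ := fun j => a (i.val + j.val + 2) + a (2 * n - (i.val + j.val))
  have hK : ∀ j, 0 ≤ K j := fun j => add_nonneg (ha _) (ha _)
  have hrow : ∑ j : Fin n, (a (Nat.dist i.val j.val) + K j) < 2 * α := by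
    rw [Fin.sum_univ_eq_sum_range
      (fun j => a (Nat.dist i.val j) + (a (i.val + j + 2) + a (2 * n - (i.val + j))))]
    have := sum_toeplitz_row_add_hankel_row_le ha ha0
      (fun k => offDiag_eq_zero_of_le (tC α)) i.isLt
    linarith [sum_range_offDiag_lt hα n]
  rw [← Finset.sum_erase_add _ _ (Finset.mem_univ i), Nat.dist_self, ha0, zero_add] at hrow
  have hoff : ∀ j ∈ Finset.univ.erase i,
      ‖(toeplitzM n (tC α) - μ • hankelM n (tC α)) i j‖ ≤ a (Nat.dist i.val j.val) + K j := by
    intro j hj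
    have hij : i ≠ j := (Finset.ne_of_mem_erase hj).symm
    have hle : K j ≤ a (Nat.dist i.val j.val) := offDiag_hankel_le hα hij
    rw [Matrix.sub_apply, Matrix.smul_apply, toeplitzM_eq_neg_offDiag _ hij,
      hankelM_eq_neg_offDiag, smul_eq_mul, Real.norm_eq_abs, abs_le]
    change -(_ + K j) ≤ -a _ - μ * -K j ∧ -a _ - μ * -K j ≤ _ + K j
    constructor <;> nlinarith [hK j]
  have hdiag : 2 * α - K i ≤ ‖(toeplitzM n (tC α) - μ • hankelM n (tC α)) i i‖ := by
    refine le_trans ?_ (Real.le_norm_self _)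
    rw [Matrix.sub_apply, Matrix.smul_apply, hankelM_eq_neg_offDiag, toeplitzM, Nat.dist_self,
      tC_zero, smul_eq_mul]
    change 2 * α - K i ≤ 2 * α - μ * -K i
    nlinarith [hK i]
  linarith [Finset.sum_le_sum hoff]

theorem tauInv_hankel_spectrum (α : ℝ) (hα : α ∈ Set.Ioo (1 : ℝ) 2) (n : ℕ) (hn : 1 ≤ n)
    (lam : ℝ) (z : Fin n → ℝ) (hz : z ≠ 0)
    (h : (hankelM n (tC α)).mulVec z = lam • (tauM n (tC α)).mulVec z) :
    |lam| < 1 / 2 := by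
  by_contra hlam
  push Not at hlam
  have hlam0 : lam ≠ 0 := by
    rintro rfl
    norm_num at hlam
  have hinv : |1 / lam| ≤ 2 := by
    rw [abs_div, abs_one, div_le_iff₀ (abs_pos.mpr hlam0)]
    linarith
  obtain ⟨hlo, hhi⟩ := abs_le.mp hinv
  refine hz (Matrix.eq_zero_of_mulVec_eq_zero
    (det_toeplitzM_sub_smul_hankelM_ne_zero hα n (μ := 1 + 1 / lam)
      (by linarith) (by linarith)) ?_)
  rw [tauM, Matrix.sub_mulVec] at h
  rw [Matrix.sub_mulVec, Matrix.smul_mulVec]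
  funext i
  have hi := congrFun h i
  simp only [Pi.smul_apply, Pi.sub_apply, smul_eq_mul, Pi.zero_apply] at hi ⊢
  field_simp
  linear_combination -hi
end

section
/- Let m ≥ 1 be an integer, and for each i ∈ {1,…,m} let α_i ∈ (1,2), w_i > 0, and n_i ≥ 1. Let A and P be the multilevel matrices A = Σ_{i=1}^m I_{n_1}⊗⋯⊗(w_i·G_{n_i}^{(α_i)})⊗⋯⊗I_{n_m} and P = Σ_{i=1}^m I_{n_1}⊗⋯⊗(w_i·τ(G_{n_i}^{(α_i)}))⊗⋯⊗I_{n_m} of size N = n_1⋯n_m. If λ, μ ∈ ℝ and z, y ∈ ℝ^N are nonzero vectors with A·z = λ·P·z and A·y = μ·P·y, then μ > 0 and λ/μ < 3; that is, the spectral condition number of P^{−1}A is less than 3. -/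
/-- The multilevel matrix `Σ_i I_{n_1}⊗⋯⊗M_i⊗⋯⊗I_{n_m}`, indexed by tuples `x y` with
`(x,y)` entry `Σ_i (M_i)_{x_i y_i} · Π_{j ≠ i} [x_j = y_j]`. -/
noncomputable def multilevel {m : ℕ} (n : Fin m → ℕ)
    (M : (i : Fin m) → Matrix (Fin (n i)) (Fin (n i)) ℝ) :
    Matrix ((i : Fin m) → Fin (n i)) ((i : Fin m) → Fin (n i)) ℝ :=
  fun x y => ∑ i, M i (x i) (y i) * ∏ j ∈ Finset.univ.erase i, (if x j = y j then (1 : ℝ) else 0)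

/-- A symmetric real matrix that is strictly diagonally dominant by rows, with positive diagonal,
has a positive quadratic form. -/
theorem dotProduct_mulVec_pos_of_sum_abs_lt {ι : Type*} [Fintype ι] [DecidableEq ι]
    {M : Matrix ι ι ℝ} (hM : ∀ x y, M x y = M y x) (hdom : ∀ x, ∑ y, |M x y| < 2 * M x x)
    {z : ι → ℝ} (hz : z ≠ 0) : 0 < z ⬝ᵥ M.mulVec z := by
  have hdiag (x : ι) : 0 ≤ M x x := by
    have h0 : 0 ≤ ∑ y, |M x y| := Finset.sum_nonneg fun _ _ => abs_nonneg _
    linarith [hdom x]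
  have hpt (x y : ι) : (if x = y then 2 * M x x * z x ^ 2 else 0)
      - (|M x y| * z x ^ 2 + |M x y| * z y ^ 2) / 2 ≤ z x * (M x y * z y) := by
    split_ifs with h
    · subst h
      rw [abs_of_nonneg (hdiag x)]
      nlinarith
    · rcases abs_cases (M x y) with ⟨h, h'⟩ | ⟨h, h'⟩ <;> rw [h]
      · nlinarith [mul_nonneg h' (sq_nonneg (z x + z y))]
      · nlinarith [mul_nonneg (neg_nonneg.2 h'.le) (sq_nonneg (z x - z y))]
  have hswap : ∑ x, ∑ y, |M x y| * z y ^ 2 = ∑ x, ∑ y, |M x y| * z x ^ 2 := by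
    rw [Finset.sum_comm]
    exact Finset.sum_congr rfl fun x _ => Finset.sum_congr rfl fun y _ => by rw [hM]
  have hsum : ∑ x, ∑ y, ((if x = y then 2 * M x x * z x ^ 2 else 0)
      - (|M x y| * z x ^ 2 + |M x y| * z y ^ 2) / 2)
      = ∑ x, (2 * M x x - ∑ y, |M x y|) * z x ^ 2 := by
    simp only [Finset.sum_sub_distrib, ← Finset.sum_div, Finset.sum_add_distrib, hswap, sub_mul,
      Finset.sum_ite_eq, Finset.mem_univ, if_true, Finset.sum_mul]
    ring
  have hpos : 0 < ∑ x, (2 * M x x - ∑ y, |M x y|) * z x ^ 2 := by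
    obtain ⟨x, hx⟩ := Function.ne_iff.1 hz
    refine Finset.sum_pos' (fun y _ => mul_nonneg (sub_nonneg.2 (hdom y).le) (sq_nonneg _))
      ⟨x, Finset.mem_univ x, mul_pos (sub_pos.2 (hdom x)) (sq_pos_of_ne_zero hx)⟩
  rw [← hsum] at hpos
  refine hpos.trans_le ?_
  simp only [dotProduct, Matrix.mulVec, Finset.mul_sum]
  exact Finset.sum_le_sum fun x _ => Finset.sum_le_sum fun y _ => hpt x y

/-- If `P` has nonpositive off-diagonal entries, `H` is entrywise nonpositive and `P + 2H` has
positive row sums, then `P + sH` is strictly diagonally dominant for `|s| ≤ 2`. -/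
theorem sum_abs_add_mul_lt {ι : Type*} [Fintype ι] [DecidableEq ι] {P H : Matrix ι ι ℝ} {s : ℝ}
    (hs : |s| ≤ 2) (hP : ∀ x y, x ≠ y → P x y ≤ 0) (hH : ∀ x y, H x y ≤ 0)
    (hrow : ∀ x, 0 < ∑ y, (P x y + 2 * H x y)) (x : ι) :
    ∑ y, |P x y + s * H x y| < 2 * (P x x + s * H x x) := by
  obtain ⟨hs1, hs2⟩ := abs_le.1 hs
  have hle (x y : ι) : P x y + 2 * H x y ≤ P x y + s * H x y := by nlinarith [hH x y]
  have hdiag : 0 ≤ P x x + 2 * H x x := by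
    have h := hrow x
    rw [← Finset.add_sum_erase _ _ (Finset.mem_univ x)] at h
    have : ∑ y ∈ Finset.univ.erase x, (P x y + 2 * H x y) ≤ 0 := Finset.sum_nonpos fun y hy => by
      linarith [hP x y (Finset.ne_of_mem_erase hy).symm, hH x y]
    linarith
  have hpt (y : ι) : |P x y + s * H x y| ≤ -(P x y + 2 * H x y) +
      if x = y then (P x x + s * H x x) + (P x x + 2 * H x x) else 0 := by
    split_ifs with h
    · subst h
      rw [abs_of_nonneg (hdiag.trans (hle x x))]
      linarith
    · rw [abs_le]
      constructor
      · linarith [hle x y]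
      · nlinarith [hP x y h, hH x y]
  have hsum := Finset.sum_le_sum fun y (_ : y ∈ Finset.univ) => hpt y
  rw [Finset.sum_add_distrib, Finset.sum_neg_distrib, Finset.sum_ite_eq,
    if_pos (Finset.mem_univ x)] at hsum
  linarith [hrow x, hle x x]

section Toeplitz

variable {n : ℕ} {t : ℕ → ℝ}

theorem tpad_nonpos (hneg : ∀ k, 1 ≤ k → t k ≤ 0) {k : ℕ} (hk : 1 ≤ k) : tpad n t k ≤ 0 := by
  unfold tpad
  split_ifs
  exacts [hneg k hk, le_rfl]

theorem toeplitzM_symm (i j : Fin n) : toeplitzM n t i j = toeplitzM n t j i := by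
  simp only [toeplitzM, Nat.dist_comm]

theorem hankelM_symm (i j : Fin n) : hankelM n t i j = hankelM n t j i := by
  simp only [hankelM, add_comm]

theorem hankelM_nonpos (hneg : ∀ k, 1 ≤ k → t k ≤ 0) (i j : Fin n) : hankelM n t i j ≤ 0 :=
  add_nonpos (tpad_nonpos hneg (by omega)) (tpad_nonpos hneg (by omega))

theorem tauM_nonpos_of_ne (hneg : ∀ k, 1 ≤ k → t k ≤ 0)
    (hmono : ∀ k l, 1 ≤ k → k ≤ l → t k ≤ t l) {i j : Fin n} (hij : i ≠ j) :
    tauM n t i j ≤ 0 := by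
  have hij' : i.val ≠ j.val := Fin.val_ne_of_ne hij
  have hd : 1 ≤ Nat.dist i.val j.val := by unfold Nat.dist; omega
  simp only [tauM, Matrix.sub_apply, toeplitzM, hankelM, tpad]
  split_ifs with h1 h2 h2
  · omega
  · have := hmono _ (i.val + j.val + 2) hd (by unfold Nat.dist; omega)
    linarith
  · have := hmono _ (2 * n - (i.val + j.val)) hd (by unfold Nat.dist; omega)
    linarith
  · linarith [hneg _ hd]

theorem sum_range_tpad {N : ℕ} (h : n ≤ N) :
    ∑ k ∈ Finset.range N, tpad n t k = ∑ k ∈ Finset.range n, t k := by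
  rw [← Finset.sum_subset (Finset.range_mono h)]
  · exact Finset.sum_congr rfl fun k hk => if_pos (Finset.mem_range.1 hk)
  · intro k _ hk
    exact if_neg (by simpa using hk)

theorem sum_tpad_dist {i : ℕ} (hi : i < n) :
    ∑ j ∈ Finset.range n, t (Nat.dist i j) =
      ∑ k ∈ Finset.range (i + 1), tpad n t k + ∑ k ∈ Finset.range (n - i), tpad n t k - t 0 := by
  obtain ⟨d, rfl⟩ : ∃ d, n = i + (d + 1) := ⟨n - i - 1, by omega⟩
  rw [Finset.sum_range_add, Finset.sum_range_succ' (fun k => tpad _ t k) i, Nat.add_sub_cancel_left,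
    ← Finset.sum_range_reflect _ i]
  have h1 : ∑ j ∈ Finset.range i, t (Nat.dist i (i - 1 - j)) =
      ∑ k ∈ Finset.range i, tpad (i + (d + 1)) t (k + 1) := by
    refine Finset.sum_congr rfl fun j hj => ?_
    rw [Finset.mem_range] at hj
    rw [tpad, if_pos (by omega)]
    congr 1
    unfold Nat.dist; omega
  have h2 : ∑ j ∈ Finset.range (d + 1), t (Nat.dist i (i + j)) =
      ∑ k ∈ Finset.range (d + 1), tpad (i + (d + 1)) t k := by
    refine Finset.sum_congr rfl fun j hj => ?_
    rw [Finset.mem_range] at hj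
    rw [tpad, if_pos (by omega)]
    congr 1
    unfold Nat.dist; omega
  have h3 : tpad (i + (d + 1)) t 0 = t 0 := if_pos (by omega)
  rw [h1, h2, h3]
  ring

/-- The row sums of `T + H` for the Toeplitz matrix `T` and its Hankel correction `H`. -/
theorem sum_toeplitzM_add_hankelM (i : Fin n) :
    ∑ j, (toeplitzM n t i j + hankelM n t i j) =
      2 * ∑ k ∈ Finset.range n, t k - t 0 - tpad n t (i + 1) - tpad n t (n - i) := by
  obtain ⟨i, hi⟩ := i
  have h1 := sum_range_tpad (n := n) (t := t) (N := i + 1 + 1 + n) (by omega)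
  have h2 := sum_range_tpad (n := n) (t := t) (N := n - i + 1 + n) (by omega)
  rw [Finset.sum_range_add, Finset.sum_range_succ] at h1 h2
  have h3 : ∑ j ∈ Finset.range n, tpad n t (2 * n - (i + j)) =
      ∑ j ∈ Finset.range n, tpad n t (n - i + 1 + j) := by
    rw [← Finset.sum_range_reflect]
    refine Finset.sum_congr rfl fun j hj => ?_
    rw [Finset.mem_range] at hj
    congr 1
    omega
  have h4 : ∑ j ∈ Finset.range n, tpad n t (i + j + 2) =
      ∑ j ∈ Finset.range n, tpad n t (i + 1 + 1 + j) :=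
    Finset.sum_congr rfl fun j _ => by congr 1; omega
  simp only [toeplitzM, hankelM]
  rw [Fin.sum_univ_eq_sum_range
      (fun j => t (Nat.dist i j) + (tpad n t (i + j + 2) + tpad n t (2 * n - (i + j)))) n,
    Finset.sum_add_distrib, Finset.sum_add_distrib, sum_tpad_dist hi, h3, h4]
  linarith

/-- Strict diagonal dominance of `τ(T) + sH` for `|s| ≤ 2`. -/
theorem sum_abs_tauM_add_lt (hneg : ∀ k, 1 ≤ k → t k ≤ 0)
    (hmono : ∀ k l, 1 ≤ k → k ≤ l → t k ≤ t l)
    (hsum : 0 < 2 * ∑ k ∈ Finset.range n, t k - t 0) {s : ℝ} (hs : |s| ≤ 2) (i : Fin n) :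
    ∑ j, |tauM n t i j + s * hankelM n t i j| <
      2 * (tauM n t i i + s * hankelM n t i i) := by
  refine sum_abs_add_mul_lt hs (fun _ _ => tauM_nonpos_of_ne hneg hmono) (hankelM_nonpos hneg)
    (fun i => ?_) i
  have h : ∑ j, (tauM n t i j + 2 * hankelM n t i j) =
      ∑ j, (toeplitzM n t i j + hankelM n t i j) :=
    Finset.sum_congr rfl fun j _ => by simp only [tauM, Matrix.sub_apply]; ring
  rw [h, sum_toeplitzM_add_hankelM]
  have h1 : tpad n t (i + 1) ≤ 0 := tpad_nonpos hneg (by omega)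
  have h2 : tpad n t (n - i) ≤ 0 := tpad_nonpos hneg (by omega)
  linarith

end Toeplitz

section Coefficients

variable {α : ℝ}

theorem glCoef_add_two_pos (hα : α ∈ Set.Ioo (1 : ℝ) 2) (k : ℕ) : 0 < glCoef α (k + 2) := by
  obtain ⟨h1, h2⟩ := hα
  induction k with
  | zero => simp only [glCoef]; norm_num; nlinarith
  | succ k ih =>
    rw [show k + 1 + 2 = (k + 2) + 1 by ring, glCoef]
    refine mul_pos (sub_pos.2 ((div_lt_one (by positivity)).2 ?_)) ih
    push_cast
    linarith [(Nat.cast_nonneg k : (0 : ℝ) ≤ k)]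

theorem glCoef_add_three_le (hα : α ∈ Set.Ioo (1 : ℝ) 2) (k : ℕ) :
    glCoef α (k + 3) ≤ glCoef α (k + 2) := by
  have hpos := glCoef_add_two_pos hα k
  rw [glCoef]
  refine mul_le_of_le_one_left hpos.le (sub_le_self _ ?_)
  have := hα.1
  positivity

theorem mul_sum_glCoef (α : ℝ) (n : ℕ) :
    α * ∑ k ∈ Finset.range (n + 1), glCoef α k = -((n + 1) * glCoef α (n + 1)) := by
  induction n with
  | zero => simp [glCoef]
  | succ n ih =>
    rw [Finset.sum_range_succ, mul_add, ih, glCoef.eq_2 α (n + 1)]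
    have : (n : ℝ) + 1 + 1 ≠ 0 := by positivity
    push_cast
    field_simp
    ring

theorem sum_glCoef_neg (hα : α ∈ Set.Ioo (1 : ℝ) 2) (n : ℕ) :
    ∑ k ∈ Finset.range (n + 2), glCoef α k < 0 := by
  have h := mul_sum_glCoef α (n + 1)
  have hpos := glCoef_add_two_pos hα n
  have hα0 : 0 < α := one_pos.trans hα.1
  have h' : α * ∑ k ∈ Finset.range (n + 2), glCoef α k < 0 := by
    rw [h, neg_lt_zero]
    positivity
  exact (pos_iff_neg_of_mul_neg h').1 hα0

theorem tC_nonpos (hα : α ∈ Set.Ioo (1 : ℝ) 2) : ∀ k, 1 ≤ k → tC α k ≤ 0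
  | 1, _ => by
    have := glCoef_add_two_pos hα 0
    simp only [tC, glCoef.eq_1]
    linarith
  | k + 2, _ => neg_nonpos.2 (glCoef_add_two_pos hα (k + 1)).le

theorem tC_mono (hα : α ∈ Set.Ioo (1 : ℝ) 2) (k l : ℕ) (hk : 1 ≤ k) (hkl : k ≤ l) :
    tC α k ≤ tC α l := by
  induction l, hkl using Nat.le_induction with
  | base => exact le_rfl
  | succ l hl ih =>
    refine ih.trans ?_
    match l, hk.trans hl with
    | 1, _ =>
      have := glCoef_add_three_le hα 0
      simp only [tC, glCoef.eq_1]
      linarith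
    | l + 2, _ => exact neg_le_neg (glCoef_add_three_le hα (l + 1))

theorem two_mul_sum_tC (α : ℝ) (n : ℕ) :
    2 * ∑ k ∈ Finset.range (n + 2), tC α k - tC α 0 =
      -2 * ∑ k ∈ Finset.range (n + 3), glCoef α k := by
  induction n with
  | zero => simp only [Finset.sum_range_succ, Finset.sum_range_zero, tC]; ring
  | succ n ih =>
    rw [Finset.sum_range_succ, Finset.sum_range_succ _ (n + 3), tC.eq_3]
    linarith

theorem two_mul_sum_tC_pos (hα : α ∈ Set.Ioo (1 : ℝ) 2) {n : ℕ} (hn : 1 ≤ n) :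
    0 < 2 * ∑ k ∈ Finset.range n, tC α k - tC α 0 := by
  match n, hn with
  | 1, _ =>
    have := hα.1
    simp [tC, glCoef]
    linarith
  | n + 2, _ =>
    rw [two_mul_sum_tC]
    linarith [sum_glCoef_neg hα (n + 1)]

end Coefficients

section Multilevel

variable {m : ℕ} {n : Fin m → ℕ}

theorem multilevel_symm {M : (i : Fin m) → Matrix (Fin (n i)) (Fin (n i)) ℝ}
    (hM : ∀ i a b, M i a b = M i b a) (x y : (i : Fin m) → Fin (n i)) :
    multilevel n M x y = multilevel n M y x := by
  simp only [multilevel, eq_comm (a := x _) (b := y _)]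
  exact Finset.sum_congr rfl fun i _ => by rw [hM]

theorem multilevel_self (M : (i : Fin m) → Matrix (Fin (n i)) (Fin (n i)) ℝ)
    (x : (i : Fin m) → Fin (n i)) : multilevel n M x x = ∑ i, M i (x i) (x i) := by
  simp [multilevel]

theorem multilevel_linear (a b : ℝ) (M N : (i : Fin m) → Matrix (Fin (n i)) (Fin (n i)) ℝ) :
    multilevel n (fun i => a • M i + b • N i) = a • multilevel n M + b • multilevel n N := by
  ext x y
  simp only [multilevel, Matrix.add_apply, Matrix.smul_apply, smul_eq_mul, Finset.mul_sum,
    ← Finset.sum_add_distrib]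
  exact Finset.sum_congr rfl fun i _ => by ring

theorem sum_mul_prod_erase_ite (i : Fin m) (x : (i : Fin m) → Fin (n i)) (f : Fin (n i) → ℝ) :
    ∑ y : (i : Fin m) → Fin (n i),
      f (y i) * ∏ j ∈ Finset.univ.erase i, (if x j = y j then (1 : ℝ) else 0) = ∑ a, f a := by
  symm
  refine Fintype.sum_of_injective (fun a => Function.update x i a)
    (Function.update_injective x i) _ _ (fun y hy => ?_) (fun a => ?_)
  · have : ∃ j ≠ i, x j ≠ y j := by
      by_contra! h
      refine hy ⟨y i, funext fun j => ?_⟩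
      by_cases hj : j = i
      · subst hj; simp
      · simp [hj, h j hj]
    obtain ⟨j, hj, hxy⟩ := this
    rw [Finset.prod_eq_zero (Finset.mem_erase.2 ⟨hj, Finset.mem_univ j⟩) (if_neg hxy), mul_zero]
  · rw [Finset.prod_eq_one, mul_one, Function.update_self]
    intro j hj
    rw [Function.update_of_ne (Finset.ne_of_mem_erase hj), if_pos rfl]

/-- Strict diagonal dominance passes from the levels to the multilevel matrix. -/
theorem sum_abs_multilevel_lt (hm : 1 ≤ m) {M : (i : Fin m) → Matrix (Fin (n i)) (Fin (n i)) ℝ}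
    (hM : ∀ i a, ∑ b, |M i a b| < 2 * M i a a) (x : (i : Fin m) → Fin (n i)) :
    ∑ y, |multilevel n M x y| < 2 * multilevel n M x x := by
  have : NeZero m := ⟨by omega⟩
  calc ∑ y, |multilevel n M x y|
      ≤ ∑ y : (i : Fin m) → Fin (n i), ∑ i, |M i (x i) (y i)| *
          ∏ j ∈ Finset.univ.erase i, (if x j = y j then (1 : ℝ) else 0) := by
        refine Finset.sum_le_sum fun y _ => (Finset.abs_sum_le_sum_abs _ _).trans_eq ?_
        refine Finset.sum_congr rfl fun i _ => ?_
        rw [abs_mul, abs_of_nonneg (a := Finset.prod _ _)]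
        exact Finset.prod_nonneg fun j _ => by split_ifs <;> norm_num
    _ = ∑ i, ∑ b, |M i (x i) b| := by
        rw [Finset.sum_comm]
        exact Finset.sum_congr rfl fun i _ =>
          sum_mul_prod_erase_ite i x fun b => |M i (x i) b|
    _ < ∑ i, 2 * M i (x i) (x i) :=
        Finset.sum_lt_sum_of_nonempty Finset.univ_nonempty fun i _ => hM i (x i)
    _ = 2 * multilevel n M x x := by rw [multilevel_self, Finset.mul_sum]

/-- Positivity of the quadratic form of `a A + b P`, when each level `a G + b τ(G)` is of the form
`τ(G) + a H` with `|a| ≤ 2`. -/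
theorem multilevel_combination_pos (hm : 1 ≤ m) (hn : ∀ i, 1 ≤ n i) {α w : Fin m → ℝ}
    (hα : ∀ i, α i ∈ Set.Ioo (1 : ℝ) 2) (hw : ∀ i, 0 < w i) {a b : ℝ} (ha : |a| ≤ 2)
    (hab : a + b = 1) {z : ((i : Fin m) → Fin (n i)) → ℝ} (hz : z ≠ 0) :
    0 < a * (z ⬝ᵥ (multilevel n (fun i => w i • Gmat (α i) (n i))).mulVec z) +
      b * (z ⬝ᵥ (multilevel n (fun i => w i • tauM (n i) (tC (α i)))).mulVec z) := by
  have hentry (i : Fin m) (c d : Fin (n i)) :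
      (a • (w i • Gmat (α i) (n i)) + b • (w i • tauM (n i) (tC (α i)))) c d =
        w i * (tauM (n i) (tC (α i)) c d + a * hankelM (n i) (tC (α i)) c d) := by
    obtain rfl : b = 1 - a := by linarith
    simp only [Gmat, tauM, Matrix.add_apply, Matrix.smul_apply, Matrix.sub_apply, smul_eq_mul]
    ring
  have h := dotProduct_mulVec_pos_of_sum_abs_lt
    (M := multilevel n fun i => a • (w i • Gmat (α i) (n i)) + b • (w i • tauM (n i) (tC (α i))))
    (multilevel_symm fun i c d => by
      rw [hentry, hentry]
      simp only [tauM, Matrix.sub_apply, toeplitzM_symm c d, hankelM_symm c d])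
    (sum_abs_multilevel_lt hm fun i c => by
      simp only [hentry, abs_mul, abs_of_pos (hw i), ← Finset.mul_sum]
      have := mul_lt_mul_of_pos_left (sum_abs_tauM_add_lt (tC_nonpos (hα i)) (tC_mono (hα i))
        (two_mul_sum_tC_pos (hα i) (hn i)) ha c) (hw i)
      linarith) hz
  rwa [multilevel_linear, Matrix.add_mulVec, Matrix.smul_mulVec, Matrix.smul_mulVec,
    dotProduct_add, dotProduct_smul, dotProduct_smul, smul_eq_mul, smul_eq_mul] at h

/-- Every generalized eigenvalue of the pencil `(A, P)` lies in `(1/2, 3/2)`. -/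
theorem multilevel_eigenvalue_mem_Ioo (hm : 1 ≤ m) (hn : ∀ i, 1 ≤ n i) {α w : Fin m → ℝ}
    (hα : ∀ i, α i ∈ Set.Ioo (1 : ℝ) 2) (hw : ∀ i, 0 < w i) {c : ℝ}
    {z : ((i : Fin m) → Fin (n i)) → ℝ} (hz : z ≠ 0)
    (h : (multilevel n (fun i => w i • Gmat (α i) (n i))).mulVec z =
      c • (multilevel n (fun i => w i • tauM (n i) (tC (α i)))).mulVec z) :
    c ∈ Set.Ioo (1 / 2 : ℝ) (3 / 2) := by
  have h1 := multilevel_combination_pos hm hn hα hw (a := 2) (b := -1)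
    (by norm_num) (by norm_num) hz
  have h2 := multilevel_combination_pos hm hn hα hw (a := -2) (b := 3)
    (by norm_num) (by norm_num) hz
  rw [h, dotProduct_smul, smul_eq_mul] at h1 h2
  set p := z ⬝ᵥ (multilevel n (fun i => w i • tauM (n i) (tC (α i)))).mulVec z
  have hp : 0 < p := by linarith
  constructor <;> nlinarith

end Multilevel

theorem multilevel_cond_number_lt_three (m : ℕ) (hm : 1 ≤ m) (n : Fin m → ℕ)
    (hn : ∀ i, 1 ≤ n i) (α w : Fin m → ℝ) (hα : ∀ i, α i ∈ Set.Ioo (1 : ℝ) 2)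
    (hw : ∀ i, 0 < w i) (lam mu : ℝ) (z y : ((i : Fin m) → Fin (n i)) → ℝ)
    (hz : z ≠ 0) (hy : y ≠ 0)
    (h1 : (multilevel n (fun i => w i • Gmat (α i) (n i))).mulVec z =
          lam • (multilevel n (fun i => w i • tauM (n i) (tC (α i)))).mulVec z)
    (h2 : (multilevel n (fun i => w i • Gmat (α i) (n i))).mulVec y =
          mu • (multilevel n (fun i => w i • tauM (n i) (tC (α i)))).mulVec y) :
    0 < mu ∧ lam / mu < 3 := by
  obtain ⟨-, hlam⟩ := multilevel_eigenvalue_mem_Ioo hm hn hα hw hz h1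
  obtain ⟨hmu, -⟩ := multilevel_eigenvalue_mem_Ioo hm hn hα hw hy h2
  have hmu0 : 0 < mu := by linarith
  exact ⟨hmu0, (div_lt_iff₀ hmu0).2 (by linarith)⟩
end
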